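/- (Support lemma for translation covariant PVMs.) Let H ≠ 0 be a complex Hilbert space, u ∈ V(1), t a u-instant, and P a PVM on t with values in H. Suppose P is translation covariant: for every a ∈ E_u there is a unitary operator V_a on H with V_a P(E) V_a⁻¹ = P(E + a) for every Borel E ⊆ t. Then P(A) ≠ 1 for every proper affine subspace A of t (i.e. every set of the form A = q + F with q ∈ t and F a proper linear subspace of E_u); in particular the support of P is not contained in any proper affine subspace of t. -/

import Mathlib

open scoped InnerProductSpace Pointwise

noncomputable section

/-- Minkowski spacetime vectors: `𝐌 = ℝ⁴`. -/
abbrev M4 : Type := Fin 4 → ℝ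

/-- The Lorentz product of signature `(−,+,+,+)`. -/
def lprod (x y : M4) : ℝ := -(x 0 * y 0) + x 1 * y 1 + x 2 * y 2 + x 3 * y 3

/-- Future directed timelike vectors. -/
def FutureTimelike (x : M4) : Prop := lprod x x < 0 ∧ 0 < x 0

/-- The set `V(1)` of absolute velocities. -/
def V1 : Set M4 := {u | lprod u u = -1 ∧ 0 < u 0}

/-- The Lorentz product with `u`, as a linear form in the second variable. -/
def lformL (u : M4) : M4 →ₗ[ℝ] ℝ where
  toFun x := lprod u x
  map_add' x y := by simp [lprod]; ring
  map_smul' c x := by simp [lprod]; ring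

/-- The subspace `E_u = {x ∈ 𝐌 | u·x = 0}`, as a submodule of `𝐌`. -/
def Esub (u : M4) : Submodule ℝ M4 := LinearMap.ker (lformL u)

lemma mem_Esub {u x : M4} : x ∈ Esub u ↔ lprod u x = 0 := Iff.rfl

/-- The `u`-time component `τ_u(x) = −u·x`. -/
def tau (u x : M4) : ℝ := - lprod u x

/-- The `u`-space component `π_u(x) = x − τ_u(x)u`. -/
def piu (u x : M4) : M4 := x - tau u x • u

/-- The `u`-instant through `p`: the affine hyperplane `p + E_u`. -/
def Instant (u p : M4) : Set M4 := {x | lprod u (x - p) = 0}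

/-- `t` is a `u`-instant. -/
def IsInstant (u : M4) (t : Set M4) : Prop := ∃ p : M4, t = Instant u p

/-- The Lorentz group `𝓛`: linear bijections of `𝐌` preserving the Lorentz product. -/
def Lorentz : Subgroup (M4 ≃ₗ[ℝ] M4) where
  carrier := {L | ∀ x y : M4, lprod (L x) (L y) = lprod x y}
  one_mem' := fun _ _ => rfl
  mul_mem' := by
    intro a b ha hb x y
    show lprod (a (b x)) (a (b y)) = lprod x y
    rw [ha, hb]
  inv_mem' := by
    intro a ha x y
    show lprod (a.symm x) (a.symm y) = lprod x y
    conv_rhs => rw [← a.apply_symm_apply x, ← a.apply_symm_apply y]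
    exact (ha (a.symm x) (a.symm y)).symm

/-- An orthochronous (linear) Lorentz transformation maps future directed timelike
vectors to future directed timelike vectors. -/
def Orthochronous (L : M4 ≃ₗ[ℝ] M4) : Prop :=
  ∀ x : M4, FutureTimelike x → FutureTimelike (L x)

/-- The Poincaré group `𝓟`: affine bijections of `𝐌` whose linear part is a
Lorentz transformation. -/
def Poincare : Subgroup (M4 ≃ᵃ[ℝ] M4) where
  carrier := {L | L.linear ∈ Lorentz}
  one_mem' := Lorentz.one_mem
  mul_mem' := fun ha hb => Lorentz.mul_mem ha hb
  inv_mem' := fun ha => Lorentz.inv_mem ha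

/-- The set `𝓔_{u,t} = {L ∈ 𝓟 | L[t] = t}` of Poincaré transformations preserving `t`. -/
def Euct (t : Set M4) : Set ↥Poincare := {L | (L : M4 ≃ᵃ[ℝ] M4) '' t = t}

/-- The set `𝒪_u = {𝐋 ∈ 𝓛 | 𝐋u = u}`. -/
def Ou (u : M4) : Set ↥Lorentz := {L | (L : M4 ≃ₗ[ℝ] M4) u = u}

/-- A projection valued measure (PVM) on the subset `t` of spacetime, with values in
the orthogonal projections of a complex Hilbert space `H`: `P(t) = 1` and `P` is
countably additive (in the strong sense) on Borel subsets of `t`. -/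
structure PVM (H : Type*) [NormedAddCommGroup H] [InnerProductSpace ℂ H]
    [CompleteSpace H] (t : Set M4) where
  proj : Set M4 → (H →L[ℂ] H)
  idem : ∀ E, E ⊆ t → MeasurableSet E → proj E * proj E = proj E
  selfAdj : ∀ E, E ⊆ t → MeasurableSet E → IsSelfAdjoint (proj E)
  total : proj t = 1
  additive : ∀ E : ℕ → Set M4, (∀ n, E n ⊆ t) → (∀ n, MeasurableSet (E n)) →
    Pairwise (Function.onFun Disjoint E) → ∀ φ : H,
      HasSum (fun n => proj (E n) φ) (proj (⋃ n, E n) φ)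

/-- The imprimitivity condition for a single PVM on the set `t`: covariance
`U_S P(E) U_S⁻¹ = P(S[E])` under all Poincaré transformations `S` preserving `t`. -/
def ImprimAt {H : Type*} [NormedAddCommGroup H] [InnerProductSpace ℂ H] [CompleteSpace H]
    (U : ↥Poincare →* unitary (H →L[ℂ] H)) {t : Set M4} (P : PVM H t) : Prop :=
  ∀ S : ↥Poincare, (S : M4 ≃ᵃ[ℝ] M4) '' t = t →
    ∀ E, E ⊆ t → MeasurableSet E →
      (U S : H →L[ℂ] H) * P.proj E * (U S⁻¹ : H →L[ℂ] H)
        = P.proj ((S : M4 ≃ᵃ[ℝ] M4) '' E)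

/-- The imprimitivity condition for a family of PVMs indexed by all observers
`u ∈ V(1)` and all `u`-instants `t`. -/
def Imprimitivity {H : Type*} [NormedAddCommGroup H] [InnerProductSpace ℂ H] [CompleteSpace H]
    (U : ↥Poincare →* unitary (H →L[ℂ] H))
    (P : ∀ (_ : M4) (t : Set M4), PVM H t) : Prop :=
  ∀ u ∈ V1, ∀ t : Set M4, IsInstant u t → ImprimAt U (P u t)

/-- Poincaré covariance of a family of PVMs:
`U_L P_{u,t}(E) U_L⁻¹ = P_{𝐋u, L[t]}(L[E])` for orthochronous `L ∈ 𝓟`. -/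
def PoincareCov {H : Type*} [NormedAddCommGroup H] [InnerProductSpace ℂ H] [CompleteSpace H]
    (U : ↥Poincare →* unitary (H →L[ℂ] H))
    (P : ∀ (_ : M4) (t : Set M4), PVM H t) : Prop :=
  ∀ u ∈ V1, ∀ t : Set M4, IsInstant u t →
    ∀ L : ↥Poincare, Orthochronous (L : M4 ≃ᵃ[ℝ] M4).linear →
      ∀ E, E ⊆ t → MeasurableSet E →
        (U L : H →L[ℂ] H) * (P u t).proj E * (U L⁻¹ : H →L[ℂ] H)
          = (P ((L : M4 ≃ᵃ[ℝ] M4).linear u) ((L : M4 ≃ᵃ[ℝ] M4) '' t)).proj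
              ((L : M4 ≃ᵃ[ℝ] M4) '' E)

/-- support lemma for translation covariant PVMs: a translation
covariant PVM on a `u`-instant cannot give probability one to any proper affine
subspace `q + F` (`F` a proper linear subspace of `E_u`). -/
theorem stmt10 {H : Type*} [NormedAddCommGroup H] [InnerProductSpace ℂ H] [CompleteSpace H]
    [Nontrivial H] (u p : M4) (hu : u ∈ V1) (P : PVM H (Instant u p))
    (hcov : ∀ a : M4, a ∈ Esub u → ∃ V : unitary (H →L[ℂ] H),
      ∀ E, E ⊆ Instant u p → MeasurableSet E →
        (V : H →L[ℂ] H) * P.proj E * ((V⁻¹ : unitary (H →L[ℂ] H)) : H →L[ℂ] H)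
          = P.proj ((fun x => x + a) '' E)) :
    ∀ (q : M4) (F : Submodule ℝ M4), q ∈ Instant u p → F < Esub u →
      P.proj ((fun v => q + v) '' (F : Set M4)) ≠ 1 := by
  intro q F hq hF hP
  obtain ⟨a, haE, haF⟩ := SetLike.exists_of_lt hF
  set A : Set M4 := (fun v => q + v) '' (F : Set M4) with hA
  have hA_sub : A ⊆ Instant u p := by
    rintro _ ⟨v, hv, rfl⟩
    have hq' : q - p ∈ Esub u := hq
    have hqv : q - p + v ∈ Esub u := add_mem hq' (hF.le hv)
    rwa [sub_add_eq_add_sub] at hqv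
  have hA_meas : MeasurableSet A :=
    ((Homeomorph.addLeft q).isClosedMap _ F.closed_of_finiteDimensional).measurableSet
  have htrans : ∀ b ∈ Esub u, P.proj ((fun x => x + b) '' A) = 1 := by
    intro b hb
    obtain ⟨V, hV⟩ := hcov b hb
    rw [← hV A hA_sub hA_meas, hP, mul_one]
    exact congrArg Subtype.val (mul_inv_cancel V)
  have hna : ∀ n : ℕ, (n : ℝ) • a ∈ Esub u := fun n => Submodule.smul_mem _ _ haE
  have hsub : ∀ n : ℕ, (fun x => x + (n : ℝ) • a) '' A ⊆ Instant u p := by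
    rintro n _ ⟨x, hx, rfl⟩
    have hx' : x - p ∈ Esub u := hA_sub hx
    have hxa := add_mem hx' (hna n)
    rwa [sub_add_eq_add_sub] at hxa
  have hmeas : ∀ n : ℕ, MeasurableSet ((fun x => x + (n : ℝ) • a) '' A) := fun n =>
    (Homeomorph.addRight ((n : ℝ) • a)).measurableEmbedding.measurableSet_image.2 hA_meas
  have hdisj : Pairwise (Function.onFun Disjoint
      fun n : ℕ => (fun x => x + (n : ℝ) • a) '' A) := by
    intro m n hmn
    refine Set.disjoint_left.2 ?_
    rintro _ ⟨_, ⟨v, hv, rfl⟩, rfl⟩ ⟨_, ⟨w, hw, rfl⟩, hvw⟩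
    have hdiff : ((m : ℝ) - n) • a = w - v := by
      simp only [add_assoc, add_right_inj] at hvw
      rw [sub_smul, sub_eq_sub_iff_add_eq_add, hvw, add_comm]
    have hne : (m : ℝ) - n ≠ 0 := sub_ne_zero.2 (Nat.cast_injective.ne hmn)
    exact haF ((F.smul_mem_iff hne).1 (hdiff ▸ sub_mem hw hv))
  obtain ⟨φ, hφ⟩ := exists_ne (0 : H)
  have hsum := (P.additive _ hsub hmeas hdisj φ).summable
  simp only [htrans _ (hna _), one_apply_eq_self] at hsum
  exact hφ ((summable_const_iff φ).1 hsum)
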